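/- arXiv:1411.6848 — 12 statements merged into one kernel-verified Lean document; each statement's English description precedes it below -/
import Mathlib

section
/- Let n ≥ 1, let Z : ℝⁿ → (ℝⁿ →L[ℝ] ℝⁿ) assign to each point a continuous linear endomorphism, and suppose there is a constant c < 1 with ‖Z(x)‖ ≤ c (operator norm) for all x ∈ ℝⁿ. If γ : ℝ → ℝⁿ is a twice continuously differentiable 2π-periodic curve satisfying the magnetic geodesic equation γ''(s) = Z(γ(s))(γ'(s)) for all s, then γ is constant. -/
open MeasureTheory Set

lemma Continuous.memLp_restrict_Ioc {E : Type*} [NormedAddCommGroup E] {f : ℝ → E}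
    (hf : Continuous f) (p : ENNReal) (a b : ℝ) :
    MemLp f p (volume.restrict (Ioc a b)) := by
  obtain ⟨C, hC⟩ := (isCompact_Icc (a := a) (b := b)).exists_bound_of_continuousOn hf.continuousOn
  have hIoc : ∀ᵐ x ∂volume.restrict (Ioc a b), x ∈ Ioc a b := ae_restrict_mem measurableSet_Ioc
  have hm : AEStronglyMeasurable f (volume.restrict (Ioc a b)) :=
    hf.continuousOn.aestronglyMeasurable measurableSet_Ioc
  exact .of_bound hm C (hIoc.mono fun x hx ↦ hC x (Ioc_subset_Icc_self hx))

/-- **Wirtinger's inequality** for complex-valued functions on an interval of length `2π`. -/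
theorem wirtinger_inequality_complex {a b : ℝ} (hab : b - a = 2 * Real.pi) {f f' : ℝ → ℂ}
    (hf : ∀ x, HasDerivAt f (f' x) x) (hf' : Continuous f') (hper : f b = f a)
    (hmean : ∫ x in a..b, f x = 0) :
    ∫ x in a..b, ‖f x‖ ^ 2 ≤ ∫ x in a..b, ‖f' x‖ ^ 2 := by
  have hlt : a < b := by linarith [Real.pi_pos]
  have hfc : Continuous f := continuous_iff_continuousAt.2 fun x ↦ (hf x).continuousAt
  have h := hasSum_le (fun n ↦ ?_) (hasSum_sq_fourierCoeffOn hlt (hfc.memLp_restrict_Ioc 2 a b))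
    (hasSum_sq_fourierCoeffOn hlt (hf'.memLp_restrict_Ioc 2 a b))
  · rw [smul_eq_mul, smul_eq_mul] at h
    exact le_of_mul_le_mul_left h (inv_pos.2 (sub_pos.2 hlt))
  · rcases eq_or_ne n 0 with rfl | hn
    · have h0 : fourierCoeffOn hlt f 0 = 0 := by
        simp [fourierCoeffOn_eq_integral, hmean]
      simp [h0]
    · rw [fourierCoeffOn_of_hasDerivAt hlt hn (fun x _ ↦ hf x) (hf'.intervalIntegrable a b),
        hper, sub_self, mul_zero, zero_sub, ← Complex.ofReal_sub, hab]
      gcongr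
      have hn1 : (1 : ℝ) ≤ |(n : ℝ)| := by exact_mod_cast Int.one_le_abs hn
      have hpi := Real.pi_pos
      simp only [norm_mul, norm_neg, norm_div, norm_one, Complex.norm_real, Complex.norm_I,
        Complex.norm_intCast, Complex.norm_ofNat, Real.norm_eq_abs, abs_two,
        abs_of_pos hpi, mul_one]
      rw [show 1 / (2 * Real.pi * |(n : ℝ)|) * (2 * Real.pi * ‖fourierCoeffOn hlt f' n‖)
        = ‖fourierCoeffOn hlt f' n‖ / |(n : ℝ)| by field_simp]
      exact div_le_self (norm_nonneg _) hn1

/-- **Wirtinger's inequality** for curves in Euclidean space on an interval of length `2π`. -/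
theorem wirtinger_inequality_euclideanSpace {ι : Type*} [Fintype ι] {a b : ℝ}
    (hab : b - a = 2 * Real.pi) {f f' : ℝ → EuclideanSpace ℝ ι}
    (hf : ∀ x, HasDerivAt f (f' x) x) (hf' : Continuous f') (hper : f b = f a)
    (hmean : ∫ x in a..b, f x = 0) :
    ∫ x in a..b, ‖f x‖ ^ 2 ≤ ∫ x in a..b, ‖f' x‖ ^ 2 := by
  have hfc : Continuous f := continuous_iff_continuousAt.2 fun x ↦ (hf x).continuousAt
  simp only [EuclideanSpace.norm_sq_eq]
  rw [intervalIntegral.integral_finsetSum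
      fun i _ ↦ Continuous.intervalIntegrable (by fun_prop) _ _,
    intervalIntegral.integral_finsetSum
      fun i _ ↦ Continuous.intervalIntegrable (by fun_prop) _ _]
  refine Finset.sum_le_sum fun i _ ↦ ?_
  have hmean_i : ∫ x in a..b, f x i = 0 := by
    have h := (EuclideanSpace.proj (𝕜 := ℝ) i).intervalIntegral_comp_comm
      (hfc.intervalIntegrable (μ := volume) a b)
    simpa [hmean] using h
  have hderiv (x : ℝ) : HasDerivAt (fun x ↦ f x i) (f' x i) x :=
    (EuclideanSpace.proj (𝕜 := ℝ) i).hasFDerivAt.comp_hasDerivAt x (hf x)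
  simpa using wirtinger_inequality_complex hab (f := fun x ↦ (f x i : ℂ))
    (f' := fun x ↦ (f' x i : ℂ)) (fun x ↦ (hderiv x).ofReal_comp) (by fun_prop)
    (by rw [hper]) (by rw [intervalIntegral.integral_ofReal, hmean_i, Complex.ofReal_zero])

/-- If `Z : ℝⁿ → (ℝⁿ →L[ℝ] ℝⁿ)` satisfies `‖Z x‖ ≤ c < 1` for all `x`,
then any twice continuously differentiable `2π`-periodic curve `γ` with
`γ'' = Z(γ)(γ')` is constant. -/
theorem statement1 (n : ℕ) (hn : 1 ≤ n)
    (Z : EuclideanSpace ℝ (Fin n) → (EuclideanSpace ℝ (Fin n) →L[ℝ] EuclideanSpace ℝ (Fin n)))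
    (c : ℝ) (hc : c < 1) (hZ : ∀ x, ‖Z x‖ ≤ c)
    (γ : ℝ → EuclideanSpace ℝ (Fin n)) (hγ : ContDiff ℝ 2 γ)
    (hper : ∀ s : ℝ, γ (s + 2 * Real.pi) = γ s)
    (heq : ∀ s : ℝ, deriv (deriv γ) s = Z (γ s) (deriv γ s)) :
    ∀ s₁ s₂ : ℝ, γ s₁ = γ s₂ := by
  have hγd (x : ℝ) : HasDerivAt γ (deriv γ x) x :=
    (hγ.differentiable (by norm_num) x).hasDerivAt
  have hγ1 : ContDiff ℝ 1 (deriv γ) := hγ.deriv'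
  have hvd (x : ℝ) : HasDerivAt (deriv γ) (deriv (deriv γ) x) x :=
    (hγ1.differentiable (by norm_num) x).hasDerivAt
  have hvc : Continuous (deriv γ) := hγ1.continuous
  have hac : Continuous (deriv (deriv γ)) := hγ1.continuous_deriv le_rfl
  have hvper (s : ℝ) : deriv γ (s + 2 * Real.pi) = deriv γ s := by
    rw [← deriv_comp_add_const, funext hper]
  have hc0 : 0 ≤ c := (norm_nonneg _).trans (hZ 0)
  refine is_const_of_deriv_eq_zero (fun x ↦ (hγd x).differentiableAt) fun a ↦ ?_
  by_contra hva
  have hlt : a < a + 2 * Real.pi := by linarith [Real.pi_pos]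
  have hmean : ∫ x in a..(a + 2 * Real.pi), deriv γ x = 0 := by
    rw [intervalIntegral.integral_eq_sub_of_hasDerivAt (fun x _ ↦ hγd x)
      (hvc.intervalIntegrable _ _), hper, sub_self]
  have hpos : 0 < ∫ x in a..(a + 2 * Real.pi), ‖deriv γ x‖ ^ 2 :=
    intervalIntegral.integral_pos hlt (by fun_prop) (fun x _ ↦ by positivity)
      ⟨a, left_mem_Icc.2 hlt.le, by positivity⟩
  have hwirt := wirtinger_inequality_euclideanSpace (add_sub_cancel_left a _) hvd hac
    (hvper a) hmean
  have hbound : ∫ x in a..(a + 2 * Real.pi), ‖deriv (deriv γ) x‖ ^ 2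
      ≤ ∫ x in a..(a + 2 * Real.pi), c ^ 2 * ‖deriv γ x‖ ^ 2 := by
    refine intervalIntegral.integral_mono_on hlt.le
      (Continuous.intervalIntegrable (by fun_prop) _ _)
      (Continuous.intervalIntegrable (by fun_prop) _ _) fun x _ ↦ ?_
    rw [← mul_pow, heq]
    gcongr
    exact (Z (γ x)).le_of_opNorm_le (hZ _) _
  rw [intervalIntegral.integral_const_mul] at hbound
  have hc2 : c ^ 2 < 1 := pow_lt_one₀ hc0 hc two_ne_zero
  nlinarith
end

section
/- Let k ∈ ℤ, k ≠ 0, B₀ ∈ ℝ, and a, b > 0. Define φ, z : ℝ × ℝ → ℝ by φ(s,t) = ((a+b)/2)·cos(ks)·e^{−(kB₀+k²)t} + ((a−b)/2)·cos(ks)·e^{−(−kB₀+k²)t} and z(s,t) = ((a+b)/2)·sin(ks)·e^{−(kB₀+k²)t} − ((a−b)/2)·sin(ks)·e^{−(−kB₀+k²)t}. Then for all (s,t): ∂ₜφ = ∂ₛ∂ₛφ − B₀ ∂ₛz and ∂ₜz = ∂ₛ∂ₛz + B₀ ∂ₛφ, and moreover φ(s,0) = a·cos(ks), z(s,0) = b·sin(ks).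 -/
/-- The first angular coordinate of the explicit torus heat flow solution:
`φ(s,t) = ((a+b)/2)·cos(ks)·e^{−(kB₀+k²)t} + ((a−b)/2)·cos(ks)·e^{−(−kB₀+k²)t}`. -/
noncomputable def torusPhi (k : ℤ) (B₀ a b : ℝ) (s t : ℝ) : ℝ :=
  ((a + b) / 2) * Real.cos ((k : ℝ) * s) * Real.exp (-((k : ℝ) * B₀ + (k : ℝ) ^ 2) * t)
    + ((a - b) / 2) * Real.cos ((k : ℝ) * s) * Real.exp (-(-((k : ℝ) * B₀) + (k : ℝ) ^ 2) * t)

/-- The second angular coordinate of the explicit torus heat flow solution: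
`z(s,t) = ((a+b)/2)·sin(ks)·e^{−(kB₀+k²)t} − ((a−b)/2)·sin(ks)·e^{−(−kB₀+k²)t}`. -/
noncomputable def torusZ (k : ℤ) (B₀ a b : ℝ) (s t : ℝ) : ℝ :=
  ((a + b) / 2) * Real.sin ((k : ℝ) * s) * Real.exp (-((k : ℝ) * B₀ + (k : ℝ) ^ 2) * t)
    - ((a - b) / 2) * Real.sin ((k : ℝ) * s) * Real.exp (-(-((k : ℝ) * B₀) + (k : ℝ) ^ 2) * t)

theorem hasDerivAt_cos_const_mul (k s : ℝ) :
    HasDerivAt (fun x => Real.cos (k * x)) (-k * Real.sin (k * s)) s := by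
  convert ((hasDerivAt_id' s).const_mul k).cos using 1
  ring

theorem hasDerivAt_sin_const_mul (k s : ℝ) :
    HasDerivAt (fun x => Real.sin (k * x)) (k * Real.cos (k * s)) s := by
  convert ((hasDerivAt_id' s).const_mul k).sin using 1
  ring

theorem hasDerivAt_exp_const_mul (c t : ℝ) :
    HasDerivAt (fun x => Real.exp (c * x)) (c * Real.exp (c * t)) t := by
  convert ((hasDerivAt_id' t).const_mul c).exp using 1
  ring

/-- The `s`-derivative of `φ` is `-k` times the `z` with `a` and `b` interchanged. -/
theorem hasDerivAt_torusPhi_space (k : ℤ) (B₀ a b s t : ℝ) :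
    HasDerivAt (fun x => torusPhi k B₀ a b x t) (-k * torusZ k B₀ b a s t) s := by
  have h := hasDerivAt_cos_const_mul k s
  refine (((h.const_mul _).mul_const _).add ((h.const_mul _).mul_const _)).congr_deriv ?_
  unfold torusZ
  ring

/-- The `s`-derivative of `z` is `k` times the `φ` with `a` and `b` interchanged. -/
theorem hasDerivAt_torusZ_space (k : ℤ) (B₀ a b s t : ℝ) :
    HasDerivAt (fun x => torusZ k B₀ a b x t) (k * torusPhi k B₀ b a s t) s := by
  have h := hasDerivAt_sin_const_mul k s
  refine (((h.const_mul _).mul_const _).sub ((h.const_mul _).mul_const _)).congr_deriv ?_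
  unfold torusPhi
  ring

theorem hasDerivAt_torusPhi_time (k : ℤ) (B₀ a b s t : ℝ) :
    HasDerivAt (fun x => torusPhi k B₀ a b s x)
      (-k ^ 2 * torusPhi k B₀ a b s t - B₀ * (k * torusPhi k B₀ b a s t)) t := by
  refine (((hasDerivAt_exp_const_mul _ t).const_mul _).add
    ((hasDerivAt_exp_const_mul _ t).const_mul _)).congr_deriv ?_
  unfold torusPhi
  ring

theorem hasDerivAt_torusZ_time (k : ℤ) (B₀ a b s t : ℝ) :
    HasDerivAt (fun x => torusZ k B₀ a b s x)
      (-k ^ 2 * torusZ k B₀ a b s t + B₀ * (-k * torusZ k B₀ b a s t)) t := by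
  refine (((hasDerivAt_exp_const_mul _ t).const_mul _).sub
    ((hasDerivAt_exp_const_mul _ t).const_mul _)).congr_deriv ?_
  unfold torusZ
  ring

/-- the explicit pair `(φ, z)` solves the torus magnetic heat flow
`∂ₜφ = ∂ₛ∂ₛφ − B₀∂ₛz`, `∂ₜz = ∂ₛ∂ₛz + B₀∂ₛφ` with initial data `(a cos(ks), b sin(ks))`. -/
theorem statement3 (k : ℤ) (hk : k ≠ 0) (B₀ a b : ℝ) (ha : 0 < a) (hb : 0 < b) :
    (∀ s t : ℝ,
      deriv (fun t' => torusPhi k B₀ a b s t') t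
        = deriv (fun s' => deriv (fun u => torusPhi k B₀ a b u t) s') s
          - B₀ * deriv (fun s' => torusZ k B₀ a b s' t) s
      ∧ deriv (fun t' => torusZ k B₀ a b s t') t
        = deriv (fun s' => deriv (fun u => torusZ k B₀ a b u t) s') s
          + B₀ * deriv (fun s' => torusPhi k B₀ a b s' t) s)
    ∧ (∀ s : ℝ, torusPhi k B₀ a b s 0 = a * Real.cos ((k : ℝ) * s)
        ∧ torusZ k B₀ a b s 0 = b * Real.sin ((k : ℝ) * s)) := by
  refine ⟨fun s t => ⟨?_, ?_⟩, fun s => ⟨?_, ?_⟩⟩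
  · simp only [(hasDerivAt_torusPhi_space _ _ _ _ _ _).deriv,
      (hasDerivAt_torusZ_space _ _ _ _ _ _).deriv, (hasDerivAt_torusPhi_time _ _ _ _ _ _).deriv,
      ((hasDerivAt_torusZ_space _ _ _ _ _ _).const_mul _).deriv]
    ring
  · simp only [(hasDerivAt_torusPhi_space _ _ _ _ _ _).deriv,
      (hasDerivAt_torusZ_space _ _ _ _ _ _).deriv, (hasDerivAt_torusZ_time _ _ _ _ _ _).deriv,
      ((hasDerivAt_torusPhi_space _ _ _ _ _ _).const_mul _).deriv]
    ring
  · simp only [torusPhi, mul_zero, Real.exp_zero]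
    ring
  · simp only [torusZ, mul_zero, Real.exp_zero]
    ring
end

section
/- Let k ∈ ℤ, k ≥ 1, set B₀ = −k, and let a, b > 0. Define φ(s,t) = ((a+b)/2)·cos(ks)·e^{−(kB₀+k²)t} + ((a−b)/2)·cos(ks)·e^{−(−kB₀+k²)t} and z(s,t) = ((a+b)/2)·sin(ks)·e^{−(kB₀+k²)t} − ((a−b)/2)·sin(ks)·e^{−(−kB₀+k²)t}. Then for every s, (φ(s,t), z(s,t)) converges as t → ∞ to (φ∞(s), z∞(s)) := (((a+b)/2)·cos(ks), ((a+b)/2)·sin(ks)), and this nontrivial limit curve is a magnetic geodesic: φ∞''(s) = B₀ z∞'(s) and z∞''(s) = −B₀ φ∞'(s) for all s. -/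
theorem deriv_const_mul_cos_mul (c k : ℝ) :
    deriv (fun u : ℝ => c * Real.cos (k * u)) = fun u => -(c * k) * Real.sin (k * u) := by
  funext u
  have h := (((hasDerivAt_id u).const_mul k).cos).const_mul c
  simp only [id, mul_one] at h
  rw [h.deriv]
  ring

theorem deriv_const_mul_sin_mul (c k : ℝ) :
    deriv (fun u : ℝ => c * Real.sin (k * u)) = fun u => (c * k) * Real.cos (k * u) := by
  funext u
  have h := (((hasDerivAt_id u).const_mul k).sin).const_mul c
  simp only [id, mul_one] at h
  rw [h.deriv]
  ring

theorem tendsto_exp_neg_mul_atTop {r : ℝ} (hr : 0 < r) :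
    Filter.Tendsto (fun t : ℝ => Real.exp (-r * t)) Filter.atTop (nhds 0) :=
  Real.tendsto_exp_atBot.comp (Filter.tendsto_id.const_mul_atTop_of_neg (neg_neg_of_pos hr))

/-- for `B₀ = −k` (`k ≥ 1`), the explicit torus heat flow solution converges
pointwise to the nontrivial limit curve `(φ∞, z∞)(s) = ((a+b)/2)(cos ks, sin ks)`, which is
a magnetic geodesic: `φ∞'' = B₀ z∞'` and `z∞'' = −B₀ φ∞'`. -/
theorem statement5 (k : ℤ) (hk : 1 ≤ k) (B₀ : ℝ) (hB : B₀ = -(k : ℝ))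
    (a b : ℝ) (ha : 0 < a) (hb : 0 < b) :
    (∀ s : ℝ, Filter.Tendsto (fun t : ℝ => (torusPhi k B₀ a b s t, torusZ k B₀ a b s t))
        Filter.atTop
        (nhds (((a + b) / 2) * Real.cos ((k : ℝ) * s), ((a + b) / 2) * Real.sin ((k : ℝ) * s))))
    ∧ (∃ s₁ s₂ : ℝ,
        ((((a + b) / 2) * Real.cos ((k : ℝ) * s₁), ((a + b) / 2) * Real.sin ((k : ℝ) * s₁)) :
            ℝ × ℝ)
          ≠ (((a + b) / 2) * Real.cos ((k : ℝ) * s₂), ((a + b) / 2) * Real.sin ((k : ℝ) * s₂)))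
    ∧ (∀ s : ℝ,
        deriv (deriv (fun u : ℝ => ((a + b) / 2) * Real.cos ((k : ℝ) * u))) s
          = B₀ * deriv (fun u : ℝ => ((a + b) / 2) * Real.sin ((k : ℝ) * u)) s
        ∧ deriv (deriv (fun u : ℝ => ((a + b) / 2) * Real.sin ((k : ℝ) * u))) s
          = -B₀ * deriv (fun u : ℝ => ((a + b) / 2) * Real.cos ((k : ℝ) * u)) s) := by
  subst hB
  have hk0 : (0 : ℝ) < k := by exact_mod_cast (by lia : 0 < k)
  have hzero : -((k : ℝ) * -(k : ℝ) + (k : ℝ) ^ 2) = 0 := by ring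
  have hdecay := tendsto_exp_neg_mul_atTop
    (show 0 < -((k : ℝ) * -(k : ℝ)) + (k : ℝ) ^ 2 by nlinarith)
  refine ⟨fun s => Filter.Tendsto.prodMk_nhds ?_ ?_, ⟨0, Real.pi / k, fun h => ?_⟩,
    fun s => ⟨?_, ?_⟩⟩
  · unfold torusPhi
    simpa only [hzero, zero_mul, Real.exp_zero, mul_one, mul_zero, add_zero, sub_zero] using
      (hdecay.const_mul ((a - b) / 2 * Real.cos (k * s))).const_add
        ((a + b) / 2 * Real.cos (k * s))
  · unfold torusZ
    simpa only [hzero, zero_mul, Real.exp_zero, mul_one, mul_zero, add_zero, sub_zero] using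
      (hdecay.const_mul ((a - b) / 2 * Real.sin (k * s))).const_sub
        ((a + b) / 2 * Real.sin (k * s))
  · have h1 := congrArg Prod.fst h
    simp only [mul_zero, Real.cos_zero, mul_div_cancel₀ Real.pi hk0.ne', Real.cos_pi] at h1
    linarith
  · simp only [deriv_const_mul_cos_mul, deriv_const_mul_sin_mul]
    ring
  · simp only [deriv_const_mul_cos_mul, deriv_const_mul_sin_mul]
    ring
end

section
/- Let k ∈ ℤ, k ≥ 1, set B₀ = k, and let a, b > 0 with a ≠ b. Define φ(s,t) = ((a+b)/2)·cos(ks)·e^{−(kB₀+k²)t} + ((a−b)/2)·cos(ks)·e^{−(−kB₀+k²)t} and z(s,t) = ((a+b)/2)·sin(ks)·e^{−(kB₀+k²)t} − ((a−b)/2)·sin(ks)·e^{−(−kB₀+k²)t}. Then for every s, (φ(s,t), z(s,t)) converges as t → ∞ to (φ∞(s), z∞(s)) := (((a−b)/2)·cos(ks), −((a−b)/2)·sin(ks)), and this nontrivial limit curve is a magnetic geodesic: φ∞''(s) = B₀ z∞'(s) and z∞''(s) = −B₀ φ∞'(s) for all s. -/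
/-- for `B₀ = k` (`k ≥ 1`) and `a ≠ b`, the explicit torus heat flow solution
converges pointwise to the nontrivial limit curve
`(φ∞, z∞)(s) = ((a−b)/2)(cos ks, −sin ks)`, which is a magnetic geodesic:
`φ∞'' = B₀ z∞'` and `z∞'' = −B₀ φ∞'`. -/
theorem statement6 (k : ℤ) (hk : 1 ≤ k) (B₀ : ℝ) (hB : B₀ = (k : ℝ))
    (a b : ℝ) (ha : 0 < a) (hb : 0 < b) (hab : a ≠ b) :
    (∀ s : ℝ, Filter.Tendsto (fun t : ℝ => (torusPhi k B₀ a b s t, torusZ k B₀ a b s t))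
        Filter.atTop
        (nhds (((a - b) / 2) * Real.cos ((k : ℝ) * s), -(((a - b) / 2) * Real.sin ((k : ℝ) * s)))))
    ∧ (∃ s₁ s₂ : ℝ,
        ((((a - b) / 2) * Real.cos ((k : ℝ) * s₁), -(((a - b) / 2) * Real.sin ((k : ℝ) * s₁))) :
            ℝ × ℝ)
          ≠ (((a - b) / 2) * Real.cos ((k : ℝ) * s₂), -(((a - b) / 2) * Real.sin ((k : ℝ) * s₂))))
    ∧ (∀ s : ℝ,
        deriv (deriv (fun u : ℝ => ((a - b) / 2) * Real.cos ((k : ℝ) * u))) s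
          = B₀ * deriv (fun u : ℝ => -(((a - b) / 2) * Real.sin ((k : ℝ) * u))) s
        ∧ deriv (deriv (fun u : ℝ => -(((a - b) / 2) * Real.sin ((k : ℝ) * u)))) s
          = -B₀ * deriv (fun u : ℝ => ((a - b) / 2) * Real.cos ((k : ℝ) * u)) s) := by
  have hk₀ : (0 : ℝ) < k := by exact_mod_cast hk
  have hc : (a - b) / 2 ≠ 0 := div_ne_zero (sub_ne_zero.mpr hab) two_ne_zero
  subst hB
  refine ⟨fun s => ?_, ⟨0, Real.pi / k, fun h => ?_⟩, fun s => ?_⟩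
  · have hexp : Filter.Tendsto
        (fun t : ℝ => Real.exp (-((k : ℝ) * k + (k : ℝ) ^ 2) * t)) Filter.atTop (nhds 0) :=
      Real.tendsto_exp_atBot.comp
        (Filter.tendsto_id.const_mul_atTop_of_neg (neg_lt_zero.mpr (by positivity)))
    have hzero : -(-((k : ℝ) * k) + (k : ℝ) ^ 2) = 0 := by ring
    simp only [torusPhi, torusZ, hzero, zero_mul, Real.exp_zero, mul_one]
    refine Filter.Tendsto.prodMk_nhds ?_ ?_
    · simpa using (hexp.const_mul ((a + b) / 2 * Real.cos (k * s))).add_const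
        ((a - b) / 2 * Real.cos (k * s))
    · simpa using (hexp.const_mul ((a + b) / 2 * Real.sin (k * s))).sub_const
        ((a - b) / 2 * Real.sin (k * s))
  · have h₁ := mul_left_cancel₀ hc (congrArg Prod.fst h)
    rw [mul_zero, Real.cos_zero, mul_div_cancel₀ _ hk₀.ne', Real.cos_pi] at h₁
    norm_num at h₁
  · simp only [← neg_mul, deriv_const_mul_cos_mul, deriv_const_mul_sin_mul]
    constructor <;> ring
end

section
/- Let k ∈ ℤ, k ≥ 1, B₀ > k, and a, b > 0 with a ≠ b. Define φ(s,t) = ((a+b)/2)·cos(ks)·e^{−(kB₀+k²)t} + ((a−b)/2)·cos(ks)·e^{−(−kB₀+k²)t}. Then the flow diverges: sup over s ∈ ℝ of |φ(s,t)| tends to ∞ as t → ∞. -/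
/-- At each time the map factors as `cos (k s)` times its value at `s = 0`. -/
theorem torusPhi_eq_cos_mul (k : ℤ) (B₀ a b s t : ℝ) :
    torusPhi k B₀ a b s t = Real.cos ((k : ℝ) * s) * torusPhi k B₀ a b 0 t := by
  simp only [torusPhi, mul_zero, Real.cos_zero]
  ring

theorem iSup_abs_torusPhi (k : ℤ) (B₀ a b t : ℝ) :
    ⨆ s : ℝ, |torusPhi k B₀ a b s t| = |torusPhi k B₀ a b 0 t| := by
  have hle (s : ℝ) : |torusPhi k B₀ a b s t| ≤ |torusPhi k B₀ a b 0 t| := by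
    rw [torusPhi_eq_cos_mul, abs_mul]
    exact mul_le_of_le_one_left (abs_nonneg _) (Real.abs_cos_le_one _)
  exact le_antisymm (ciSup_le hle)
    (le_ciSup (f := fun s => |torusPhi k B₀ a b s t|) ⟨_, Set.forall_mem_range.2 hle⟩ 0)

/-- for `k ≥ 1`, `B₀ > k` and `a ≠ b`, the explicit torus heat flow solution
diverges: `sup_s |φ(s,t)| → ∞` as `t → ∞`. -/
theorem statement7 (k : ℤ) (hk : 1 ≤ k) (B₀ : ℝ) (hB : (k : ℝ) < B₀)
    (a b : ℝ) (ha : 0 < a) (hb : 0 < b) (hab : a ≠ b) :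
    Filter.Tendsto (fun t : ℝ => ⨆ s : ℝ, |torusPhi k B₀ a b s t|)
      Filter.atTop Filter.atTop := by
  have hk0 : (0 : ℝ) < k := by exact_mod_cast hk
  have hdecay : 0 < (k : ℝ) * B₀ + (k : ℝ) ^ 2 := by nlinarith
  have hgrow : 0 < -(-((k : ℝ) * B₀) + (k : ℝ) ^ 2) := by nlinarith
  have hc : 0 < |(a - b) / 2| := abs_pos.2 (div_ne_zero (sub_ne_zero.2 hab) two_ne_zero)
  have hlim : Filter.Tendsto
      (fun t : ℝ => |(a - b) / 2| * Real.exp (-(-((k : ℝ) * B₀) + (k : ℝ) ^ 2) * t)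
        + -((a + b) / 2)) Filter.atTop Filter.atTop :=
    Filter.tendsto_atTop_add_const_right _ _
      ((Real.tendsto_exp_atTop.comp
        (Filter.tendsto_id.const_mul_atTop hgrow)).const_mul_atTop hc)
  refine Filter.tendsto_atTop_mono' _ ?_ hlim
  filter_upwards [Filter.eventually_ge_atTop 0] with t ht
  rw [iSup_abs_torusPhi]
  simp only [torusPhi, mul_zero, Real.cos_zero, mul_one]
  set E := Real.exp (-(-((k : ℝ) * B₀) + (k : ℝ) ^ 2) * t)
  set D := Real.exp (-((k : ℝ) * B₀ + (k : ℝ) ^ 2) * t)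
  have hD : D ≤ 1 := Real.exp_le_one_iff.2 (by nlinarith)
  have hD0 : 0 < D := Real.exp_pos _
  have hE : |(a - b) / 2 * E| = |(a - b) / 2| * E := by
    rw [abs_mul, abs_of_pos (Real.exp_pos _)]
  have hDabs : |(a + b) / 2 * D| ≤ (a + b) / 2 := by
    rw [abs_of_pos (by positivity)]
    exact mul_le_of_le_one_right (by positivity) hD
  have htri := abs_sub ((a + b) / 2 * D + (a - b) / 2 * E) ((a + b) / 2 * D)
  rw [add_sub_cancel_left] at htri
  linarith
end

section
/- Let k ∈ ℤ, k ≠ 0, B₀ ∈ ℝ, a, b > 0, and T > 0. With φ(s,t) = ((a+b)/2)·cos(ks)·e^{−(kB₀+k²)t} + ((a−b)/2)·cos(ks)·e^{−(−kB₀+k²)t} and z(s,t) = ((a+b)/2)·sin(ks)·e^{−(kB₀+k²)t} − ((a−b)/2)·sin(ks)·e^{−(−kB₀+k²)t}, the magnetic term in the energy identity evaluates to ∫₀^T ∫₀^{2π} B₀·(∂ₛz·∂ₜφ − ∂ₜz·∂ₛφ) ds dt = −π a b k B₀ − (π/4)(b−a)² k B₀ e^{−2T(k²−kB₀)} + (π/4)(b+a)²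 k B₀ e^{−2T(k²+kB₀)}. -/
theorem hasDerivAt_sin_mul_left (c x : ℝ) :
    HasDerivAt (fun x => Real.sin (c * x)) (c * Real.cos (c * x)) x := by
  simpa [mul_comm] using ((hasDerivAt_id x).const_mul c).sin

theorem hasDerivAt_cos_mul_left (c x : ℝ) :
    HasDerivAt (fun x => Real.cos (c * x)) (-(c * Real.sin (c * x))) x := by
  simpa [mul_comm] using ((hasDerivAt_id x).const_mul c).cos

theorem hasDerivAt_exp_mul_left (c x : ℝ) :
    HasDerivAt (fun x => Real.exp (c * x)) (c * Real.exp (c * x)) x := by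
  simpa [mul_comm] using ((hasDerivAt_id x).const_mul c).exp

theorem integral_cos_sq_add_sin_sq_int_mul {k : ℤ} (hk : k ≠ 0) (C D : ℝ) :
    ∫ s in (0:ℝ)..(2 * Real.pi),
        (C * Real.cos ((k : ℝ) * s) ^ 2 + D * Real.sin ((k : ℝ) * s) ^ 2)
      = Real.pi * (C + D) := by
  have hk' : (k : ℝ) ≠ 0 := Int.cast_ne_zero.mpr hk
  have hsin : Real.sin ((k : ℝ) * (2 * Real.pi)) = 0 := by
    rw [show (k : ℝ) * (2 * Real.pi) = ((2 * k : ℤ) : ℝ) * Real.pi by push_cast; ring]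
    exact Real.sin_int_mul_pi _
  rw [intervalIntegral.integral_eq_sub_of_hasDerivAt
    (f := fun s => (C + D) / 2 * s
      + (C - D) / (2 * k) * (Real.sin ((k : ℝ) * s) * Real.cos ((k : ℝ) * s)))]
  · simp only [hsin, mul_zero, Real.sin_zero, zero_mul]
    ring
  · intro s _
    refine (((hasDerivAt_id s).const_mul ((C + D) / 2)).add
      (((hasDerivAt_sin_mul_left k s).mul (hasDerivAt_cos_mul_left k s)).const_mul
        ((C - D) / (2 * k)))).congr_deriv ?_
    field_simp
    linear_combination -(C + D) * Real.sin_sq_add_cos_sq ((k : ℝ) * s)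
  · exact Continuous.intervalIntegrable (by fun_prop) _ _

theorem hasDerivAt_torusPhi_left (k : ℤ) (B₀ a b s t : ℝ) :
    HasDerivAt (fun s' => torusPhi k B₀ a b s' t)
      (-(k : ℝ) * Real.sin ((k : ℝ) * s) *
        ((a + b) / 2 * Real.exp (-((k : ℝ) * B₀ + (k : ℝ) ^ 2) * t)
          + (a - b) / 2 * Real.exp (-(-((k : ℝ) * B₀) + (k : ℝ) ^ 2) * t))) s := by
  have h := hasDerivAt_cos_mul_left k s
  exact (((h.const_mul ((a + b) / 2)).mul_const _).add
    ((h.const_mul ((a - b) / 2)).mul_const _)).congr_deriv (by ring)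

theorem hasDerivAt_torusZ_left (k : ℤ) (B₀ a b s t : ℝ) :
    HasDerivAt (fun s' => torusZ k B₀ a b s' t)
      ((k : ℝ) * Real.cos ((k : ℝ) * s) *
        ((a + b) / 2 * Real.exp (-((k : ℝ) * B₀ + (k : ℝ) ^ 2) * t)
          - (a - b) / 2 * Real.exp (-(-((k : ℝ) * B₀) + (k : ℝ) ^ 2) * t))) s := by
  have h := hasDerivAt_sin_mul_left k s
  exact (((h.const_mul ((a + b) / 2)).mul_const _).sub
    ((h.const_mul ((a - b) / 2)).mul_const _)).congr_deriv (by ring)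

theorem hasDerivAt_torusPhi_right (k : ℤ) (B₀ a b s t : ℝ) :
    HasDerivAt (fun t' => torusPhi k B₀ a b s t')
      (Real.cos ((k : ℝ) * s) *
        ((a + b) / 2 * (-((k : ℝ) * B₀ + (k : ℝ) ^ 2)
            * Real.exp (-((k : ℝ) * B₀ + (k : ℝ) ^ 2) * t))
          + (a - b) / 2 * (-(-((k : ℝ) * B₀) + (k : ℝ) ^ 2)
            * Real.exp (-(-((k : ℝ) * B₀) + (k : ℝ) ^ 2) * t)))) t :=
  (((hasDerivAt_exp_mul_left _ t).const_mul _).add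
    ((hasDerivAt_exp_mul_left _ t).const_mul _)).congr_deriv (by ring)

theorem hasDerivAt_torusZ_right (k : ℤ) (B₀ a b s t : ℝ) :
    HasDerivAt (fun t' => torusZ k B₀ a b s t')
      (Real.sin ((k : ℝ) * s) *
        ((a + b) / 2 * (-((k : ℝ) * B₀ + (k : ℝ) ^ 2)
            * Real.exp (-((k : ℝ) * B₀ + (k : ℝ) ^ 2) * t))
          - (a - b) / 2 * (-(-((k : ℝ) * B₀) + (k : ℝ) ^ 2)
            * Real.exp (-(-((k : ℝ) * B₀) + (k : ℝ) ^ 2) * t)))) t :=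
  (((hasDerivAt_exp_mul_left _ t).const_mul _).sub
    ((hasDerivAt_exp_mul_left _ t).const_mul _)).congr_deriv (by ring)

/-- The magnetic term integrated over the loop, at a fixed flow time. -/
theorem integral_torus_magnetic_term {k : ℤ} (hk : k ≠ 0) (B₀ a b t : ℝ) :
    (∫ s in (0:ℝ)..(2 * Real.pi),
        B₀ * (deriv (fun s' => torusZ k B₀ a b s' t) s * deriv (fun t' => torusPhi k B₀ a b s t') t
          - deriv (fun t' => torusZ k B₀ a b s t') t * deriv (fun s' => torusPhi k B₀ a b s' t) s))
      = Real.pi / 4 * k * B₀ * ((a + b) ^ 2 * ((-2 * ((k : ℝ) ^ 2 + k * B₀))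
            * Real.exp (-2 * ((k : ℝ) ^ 2 + k * B₀) * t))
          - (a - b) ^ 2 * ((-2 * ((k : ℝ) ^ 2 - k * B₀))
            * Real.exp (-2 * ((k : ℝ) ^ 2 - k * B₀) * t))) := by
  have hP : Real.exp (-2 * ((k : ℝ) ^ 2 + k * B₀) * t)
      = Real.exp (-((k : ℝ) * B₀ + (k : ℝ) ^ 2) * t) ^ 2 := by
    rw [← Real.exp_nat_mul]; congr 1; push_cast; ring
  have hQ : Real.exp (-2 * ((k : ℝ) ^ 2 - k * B₀) * t)
      = Real.exp (-(-((k : ℝ) * B₀) + (k : ℝ) ^ 2) * t) ^ 2 := by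
    rw [← Real.exp_nat_mul]; congr 1; push_cast; ring
  simp only [(hasDerivAt_torusPhi_left k B₀ a b _ t).deriv,
    (hasDerivAt_torusZ_left k B₀ a b _ t).deriv, (hasDerivAt_torusPhi_right k B₀ a b _ t).deriv,
    (hasDerivAt_torusZ_right k B₀ a b _ t).deriv]
  rw [hP, hQ]
  generalize Real.exp (-((k : ℝ) * B₀ + (k : ℝ) ^ 2) * t) = P
  generalize Real.exp (-(-((k : ℝ) * B₀) + (k : ℝ) ^ 2) * t) = Q
  generalize hα : (k : ℝ) * B₀ + (k : ℝ) ^ 2 = α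
  generalize hβ : -((k : ℝ) * B₀) + (k : ℝ) ^ 2 = β
  rw [show (k : ℝ) ^ 2 + k * B₀ = α by rw [← hα]; ring,
    show (k : ℝ) ^ 2 - k * B₀ = β by rw [← hβ]; ring]
  trans ∫ s in (0:ℝ)..(2 * Real.pi),
      ((B₀ * k * ((a + b) / 2 * P - (a - b) / 2 * Q)
          * ((a + b) / 2 * (-α * P) + (a - b) / 2 * (-β * Q))) * Real.cos ((k : ℝ) * s) ^ 2
        + (B₀ * k * ((a + b) / 2 * P + (a - b) / 2 * Q)
          * ((a + b) / 2 * (-α * P) - (a - b) / 2 * (-β * Q))) * Real.sin ((k : ℝ) * s) ^ 2)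
  · congr 1
    ext s
    ring
  · rw [integral_cos_sq_add_sin_sq_int_mul hk]
    ring

/-- the magnetic term in the energy identity for the explicit torus heat flow
solution evaluates to the stated closed form. -/
theorem statement8 (k : ℤ) (hk : k ≠ 0) (B₀ a b T : ℝ) (ha : 0 < a) (hb : 0 < b) (hT : 0 < T) :
    (∫ t in (0:ℝ)..T, ∫ s in (0:ℝ)..(2 * Real.pi),
        B₀ * (deriv (fun s' => torusZ k B₀ a b s' t) s * deriv (fun t' => torusPhi k B₀ a b s t') t
          - deriv (fun t' => torusZ k B₀ a b s t') t * deriv (fun s' => torusPhi k B₀ a b s' t) s))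
      = -(Real.pi * a * b * (k : ℝ) * B₀)
        - (Real.pi / 4) * (b - a) ^ 2 * (k : ℝ) * B₀ *
            Real.exp (-2 * T * ((k : ℝ) ^ 2 - (k : ℝ) * B₀))
        + (Real.pi / 4) * (b + a) ^ 2 * (k : ℝ) * B₀ *
            Real.exp (-2 * T * ((k : ℝ) ^ 2 + (k : ℝ) * B₀)) := by
  simp only [integral_torus_magnetic_term hk]
  rw [intervalIntegral.integral_eq_sub_of_hasDerivAt (fun t _ =>
    ((((hasDerivAt_exp_mul_left _ t).const_mul _).sub
      ((hasDerivAt_exp_mul_left _ t).const_mul _)).const_mul _))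
    (Continuous.intervalIntegrable (by fun_prop) _ _)]
  simp only [Pi.sub_apply, mul_zero, Real.exp_zero, mul_right_comm (-2 : ℝ) T]
  ring
end

section
/- Let k ∈ ℤ, k ≥ 1, a, b > 0 with a ≠ b, and B₀ ∈ ℝ. Define F : [0,∞) → ℝ by F(T) = −π a b k B₀ − (π/4)(b−a)² k B₀ e^{−2T(k²−kB₀)} + (π/4)(b+a)² k B₀ e^{−2T(k²+kB₀)}. Then the set {F(T) : T ∈ [0,∞)} is bounded below if and only if |B₀| ≤ k. -/
/-- The closed-form value of the magnetic term in the energy identity along the explicit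
torus heat flow solution with initial data `(a cos(ks), b sin(ks))`. -/
noncomputable def magneticTermTorus (k : ℤ) (B₀ a b : ℝ) (T : ℝ) : ℝ :=
  -(Real.pi * a * b * (k : ℝ) * B₀)
    - (Real.pi / 4) * (b - a) ^ 2 * (k : ℝ) * B₀ *
        Real.exp (-2 * T * ((k : ℝ) ^ 2 - (k : ℝ) * B₀))
    + (Real.pi / 4) * (b + a) ^ 2 * (k : ℝ) * B₀ *
        Real.exp (-2 * T * ((k : ℝ) ^ 2 + (k : ℝ) * B₀))

/-- A sum of a constant and two non-growing exponentials is bounded below on `[0, ∞)`. -/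
theorem bddBelow_image_add_exp_add_exp (K c d : ℝ) {p q : ℝ} (hp : 0 ≤ p) (hq : 0 ≤ q) :
    BddBelow ((fun T : ℝ => K + c * Real.exp (-(p * T)) + d * Real.exp (-(q * T))) ''
      Set.Ici 0) := by
  have key : ∀ (e r T : ℝ), 0 ≤ r → 0 ≤ T → -|e| ≤ e * Real.exp (-(r * T)) := by
    intro e r T hr hT
    have h1 : Real.exp (-(r * T)) ≤ 1 := Real.exp_le_one_iff.2 (by nlinarith [mul_nonneg hr hT])
    have h2 : |e * Real.exp (-(r * T))| ≤ |e| := by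
      rw [abs_mul, Real.abs_exp]
      exact mul_le_of_le_one_right (abs_nonneg e) h1
    exact (abs_le.1 h2).1
  refine ⟨K - |c| - |d|, ?_⟩
  rintro _ ⟨T, hT, rfl⟩
  dsimp only
  linarith [key c p T hp hT, key d q T hq hT]

/-- A growing exponential with negative coefficient dominates a non-growing one. -/
theorem not_bddBelow_image_sub_exp_add_exp (K : ℝ) {c d p q : ℝ} (hc : 0 < c) (hd : 0 ≤ d)
    (hp : 0 < p) (hq : 0 ≤ q) :
    ¬ BddBelow ((fun T : ℝ => K - c * Real.exp (p * T) + d * Real.exp (-(q * T))) ''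
      Set.Ici 0) := by
  rintro ⟨m, hm⟩
  have hT : 0 ≤ |K + d - m| / (c * p) := by positivity
  set T := |K + d - m| / (c * p) with hTdef
  have h := hm (Set.mem_image_of_mem _ (Set.mem_Ici.2 hT))
  have h1 : c * (p * T + 1) ≤ c * Real.exp (p * T) :=
    mul_le_mul_of_nonneg_left (Real.add_one_le_exp _) hc.le
  have h2 : d * Real.exp (-(q * T)) ≤ d :=
    mul_le_of_le_one_right hd (Real.exp_le_one_iff.2 (by nlinarith [mul_nonneg hq hT]))
  have h3 : c * p * T = |K + d - m| := by
    rw [hTdef]; field_simp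
  linarith [le_abs_self (K + d - m)]

/-- the magnetic term `F(T)` of the torus flow is bounded below on `[0,∞)`
if and only if `|B₀| ≤ k`. -/
theorem statement9 (k : ℤ) (hk : 1 ≤ k) (a b : ℝ) (ha : 0 < a) (hb : 0 < b) (hab : a ≠ b)
    (B₀ : ℝ) :
    BddBelow (magneticTermTorus k B₀ a b '' Set.Ici 0) ↔ |B₀| ≤ (k : ℝ) := by
  have hk0 : (0 : ℝ) < k := by exact_mod_cast hk
  have hsub : 0 < (b - a) ^ 2 := by
    have : b - a ≠ 0 := sub_ne_zero.2 hab.symm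
    positivity
  have hadd : 0 < (b + a) ^ 2 := by positivity
  have hpi := Real.pi_pos
  constructor
  · intro h
    by_contra! hB
    rcases lt_abs.1 hB with hB | hB
    · have hB0 : 0 < B₀ := hk0.trans hB
      refine not_bddBelow_image_sub_exp_add_exp (-(Real.pi * a * b * k * B₀))
        (c := Real.pi / 4 * (b - a) ^ 2 * k * B₀) (d := Real.pi / 4 * (b + a) ^ 2 * k * B₀)
        (p := 2 * (k * (B₀ - k))) (q := 2 * (k * (k + B₀)))
        (by positivity) (by positivity)
        (mul_pos two_pos (mul_pos hk0 (sub_pos.2 hB))) (by positivity) ?_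
      convert h using 2
      unfold magneticTermTorus
      ring_nf
    · have hB0 : 0 < -B₀ := hk0.trans hB
      refine not_bddBelow_image_sub_exp_add_exp (-(Real.pi * a * b * k * B₀))
        (c := Real.pi / 4 * (b + a) ^ 2 * k * -B₀) (d := Real.pi / 4 * (b - a) ^ 2 * k * -B₀)
        (p := 2 * (k * (-B₀ - k))) (q := 2 * (k * (k + -B₀)))
        (by positivity) (by positivity)
        (mul_pos two_pos (mul_pos hk0 (sub_pos.2 hB))) (by positivity) ?_
      convert h using 2
      unfold magneticTermTorus
      ring_nf
  · intro hB
    obtain ⟨h1, h2⟩ := abs_le.1 hB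
    have hp : 0 ≤ 2 * (k * (k - B₀)) :=
      mul_nonneg two_pos.le (mul_nonneg hk0.le (by linarith))
    have hq : 0 ≤ 2 * (k * (k + B₀)) :=
      mul_nonneg two_pos.le (mul_nonneg hk0.le (by linarith))
    convert bddBelow_image_add_exp_add_exp (-(Real.pi * a * b * k * B₀))
      (-(Real.pi / 4 * (b - a) ^ 2 * k * B₀)) (Real.pi / 4 * (b + a) ^ 2 * k * B₀) hp hq using 2
    unfold magneticTermTorus
    ring_nf
end

section
/- Let B₀ ∈ ℝ and μ > 0. Define φ, z : ℝ × ℝ → ℝ by φ(s,t) = s + (μ/2)·sin(s)·(e^{(B₀−1)t} − e^{−(B₀+1)t}) and z(s,t) = B₀ t + (μ/2)·cos(s)·(e^{(B₀−1)t} + e^{−(B₀+1)t}). Then for all (s,t): ∂ₜφ = ∂ₛ∂ₛφ − B₀ ∂ₛz and ∂ₜz = ∂ₛ∂ₛz + B₀ ∂ₛφ, and moreover φ(s,0) = s, z(s,0) = μ·cos(s). -/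
/-- The first angular coordinate of the torus heat flow solution with non-contractible
initial curve: `φ(s,t) = s + (μ/2)·sin s·(e^{(B₀−1)t} − e^{−(B₀+1)t})`. -/
noncomputable def torusPhi' (B₀ μ : ℝ) (s t : ℝ) : ℝ :=
  s + (μ / 2) * Real.sin s * (Real.exp ((B₀ - 1) * t) - Real.exp (-((B₀ + 1) * t)))

/-- The second angular coordinate of the torus heat flow solution with non-contractible
initial curve: `z(s,t) = B₀t + (μ/2)·cos s·(e^{(B₀−1)t} + e^{−(B₀+1)t})`. -/
noncomputable def torusZ' (B₀ μ : ℝ) (s t : ℝ) : ℝ :=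
  B₀ * t + (μ / 2) * Real.cos s * (Real.exp ((B₀ - 1) * t) + Real.exp (-((B₀ + 1) * t)))

theorem hasDerivAt_torusPhi'_time (B₀ μ s t : ℝ) :
    HasDerivAt (fun t' => torusPhi' B₀ μ s t')
      ((μ / 2) * Real.sin s * ((B₀ - 1) * Real.exp ((B₀ - 1) * t)
        + (B₀ + 1) * Real.exp (-((B₀ + 1) * t)))) t := by
  have h₁ := ((hasDerivAt_id' t).const_mul (B₀ - 1)).exp
  have h₂ := ((hasDerivAt_id' t).const_mul (B₀ + 1)).fun_neg.exp
  refine (((h₁.fun_sub h₂).const_mul ((μ / 2) * Real.sin s)).const_add s).congr_deriv ?_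
  ring

theorem hasDerivAt_torusZ'_time (B₀ μ s t : ℝ) :
    HasDerivAt (fun t' => torusZ' B₀ μ s t')
      (B₀ + (μ / 2) * Real.cos s * ((B₀ - 1) * Real.exp ((B₀ - 1) * t)
        - (B₀ + 1) * Real.exp (-((B₀ + 1) * t)))) t := by
  have h₁ := ((hasDerivAt_id' t).const_mul (B₀ - 1)).exp
  have h₂ := ((hasDerivAt_id' t).const_mul (B₀ + 1)).fun_neg.exp
  refine (((hasDerivAt_id' t).const_mul B₀).fun_add
    ((h₁.fun_add h₂).const_mul ((μ / 2) * Real.cos s))).congr_deriv ?_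
  ring

theorem hasDerivAt_torusPhi'_space (B₀ μ s t : ℝ) :
    HasDerivAt (fun s' => torusPhi' B₀ μ s' t)
      (1 + (μ / 2) * Real.cos s * (Real.exp ((B₀ - 1) * t) - Real.exp (-((B₀ + 1) * t)))) s :=
  (hasDerivAt_id' s).fun_add (((Real.hasDerivAt_sin s).const_mul (μ / 2)).mul_const _)

theorem hasDerivAt_torusZ'_space (B₀ μ s t : ℝ) :
    HasDerivAt (fun s' => torusZ' B₀ μ s' t)
      ((μ / 2) * -Real.sin s * (Real.exp ((B₀ - 1) * t) + Real.exp (-((B₀ + 1) * t)))) s :=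
  (((Real.hasDerivAt_cos s).const_mul (μ / 2)).mul_const _).const_add _

theorem hasDerivAt_deriv_torusPhi'_space (B₀ μ s t : ℝ) :
    HasDerivAt (fun s' => deriv (fun u => torusPhi' B₀ μ u t) s')
      ((μ / 2) * -Real.sin s * (Real.exp ((B₀ - 1) * t) - Real.exp (-((B₀ + 1) * t)))) s := by
  simp only [(hasDerivAt_torusPhi'_space B₀ μ _ t).deriv]
  exact (((Real.hasDerivAt_cos s).const_mul (μ / 2)).mul_const _).const_add 1

theorem hasDerivAt_deriv_torusZ'_space (B₀ μ s t : ℝ) :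
    HasDerivAt (fun s' => deriv (fun u => torusZ' B₀ μ u t) s')
      ((μ / 2) * -Real.cos s * (Real.exp ((B₀ - 1) * t) + Real.exp (-((B₀ + 1) * t)))) s := by
  simp only [(hasDerivAt_torusZ'_space B₀ μ _ t).deriv]
  exact ((Real.hasDerivAt_sin s).fun_neg.const_mul (μ / 2)).mul_const _

/-- the explicit pair `(φ, z)` solves the torus magnetic heat flow
`∂ₜφ = ∂ₛ∂ₛφ − B₀∂ₛz`, `∂ₜz = ∂ₛ∂ₛz + B₀∂ₛφ` with initial data `(s, μ·cos s)`. -/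
theorem statement10 (B₀ μ : ℝ) (hμ : 0 < μ) :
    (∀ s t : ℝ,
      deriv (fun t' => torusPhi' B₀ μ s t') t
        = deriv (fun s' => deriv (fun u => torusPhi' B₀ μ u t) s') s
          - B₀ * deriv (fun s' => torusZ' B₀ μ s' t) s
      ∧ deriv (fun t' => torusZ' B₀ μ s t') t
        = deriv (fun s' => deriv (fun u => torusZ' B₀ μ u t) s') s
          + B₀ * deriv (fun s' => torusPhi' B₀ μ s' t) s)
    ∧ (∀ s : ℝ, torusPhi' B₀ μ s 0 = s ∧ torusZ' B₀ μ s 0 = μ * Real.cos s) := by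
  refine ⟨fun s t => ⟨?_, ?_⟩, fun s => ⟨?_, ?_⟩⟩
  · rw [(hasDerivAt_torusPhi'_time B₀ μ s t).deriv,
      (hasDerivAt_deriv_torusPhi'_space B₀ μ s t).deriv,
      (hasDerivAt_torusZ'_space B₀ μ s t).deriv]
    ring
  · rw [(hasDerivAt_torusZ'_time B₀ μ s t).deriv,
      (hasDerivAt_deriv_torusZ'_space B₀ μ s t).deriv,
      (hasDerivAt_torusPhi'_space B₀ μ s t).deriv]
    ring
  · simp [torusPhi']
  · simp only [torusZ', mul_zero, neg_zero, Real.exp_zero]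
    ring
end

section
/- Let θ₀, B₀ ∈ ℝ with cos θ₀ ≠ 0 and set ω = B₀ / cos θ₀. The curve γ : ℝ → ℝ³ given by γ(s) = (sin θ₀ · cos(ω s), sin θ₀ · sin(ω s), cos θ₀) satisfies the magnetic geodesic equation on the two-sphere: γ''(s) = −‖γ'(s)‖² γ(s) + B₀ (γ(s) × γ'(s)) for all s, where × is the cross product in ℝ³ and ‖·‖ the Euclidean norm. -/
/-- The cross product of two vectors in Euclidean `ℝ³`. -/
noncomputable def cross3 (v w : EuclideanSpace ℝ (Fin 3)) : EuclideanSpace ℝ (Fin 3) :=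
  (WithLp.equiv 2 (Fin 3 → ℝ)).symm
    ![v 1 * w 2 - v 2 * w 1, v 2 * w 0 - v 0 * w 2, v 0 * w 1 - v 1 * w 0]

/-- The circle of latitude `θ₀` on the unit sphere, traversed with angular velocity `ω`. -/
noncomputable def latitudeCurve (θ₀ ω : ℝ) (s : ℝ) : EuclideanSpace ℝ (Fin 3) :=
  (WithLp.equiv 2 (Fin 3 → ℝ)).symm
    ![Real.sin θ₀ * Real.cos (ω * s), Real.sin θ₀ * Real.sin (ω * s), Real.cos θ₀]

/-- Derivative of a curve in Euclidean `ℝ³` given by its three coordinates. -/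
theorem hasDerivAt_euclidean_three {f g h : ℝ → ℝ} {f' g' h' s : ℝ} (hf : HasDerivAt f f' s)
    (hg : HasDerivAt g g' s) (hh : HasDerivAt h h' s) :
    HasDerivAt (fun t => (!₂[f t, g t, h t] : EuclideanSpace ℝ (Fin 3))) !₂[f', g', h'] s := by
  have hpi : HasDerivAt (fun t => ![f t, g t, h t]) ![f', g', h'] s := by
    rw [hasDerivAt_pi]
    intro i
    fin_cases i
    · simpa using hf
    · simpa using hg
    · simpa using hh
  exact (PiLp.continuousLinearEquiv 2 ℝ fun _ : Fin 3 => ℝ).symm.hasFDerivAt.comp_hasDerivAt s hpi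

theorem deriv_latitudeCurve (θ₀ ω : ℝ) :
    deriv (latitudeCurve θ₀ ω) = fun s =>
      !₂[-(Real.sin θ₀ * ω * Real.sin (ω * s)), Real.sin θ₀ * ω * Real.cos (ω * s), 0] := by
  funext s
  have hω : HasDerivAt (fun t => ω * t) ω s := by simpa using (hasDerivAt_id s).const_mul ω
  refine (hasDerivAt_euclidean_three ?_ ?_ (hasDerivAt_const s (Real.cos θ₀))).deriv
  · exact (hω.cos.const_mul (Real.sin θ₀)).congr_deriv (by ring)
  · exact (hω.sin.const_mul (Real.sin θ₀)).congr_deriv (by ring)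

theorem deriv_deriv_latitudeCurve (θ₀ ω : ℝ) :
    deriv (deriv (latitudeCurve θ₀ ω)) = fun s =>
      !₂[-(Real.sin θ₀ * ω ^ 2 * Real.cos (ω * s)),
        -(Real.sin θ₀ * ω ^ 2 * Real.sin (ω * s)), 0] := by
  rw [deriv_latitudeCurve]
  funext s
  have hω : HasDerivAt (fun t => ω * t) ω s := by simpa using (hasDerivAt_id s).const_mul ω
  refine (hasDerivAt_euclidean_three ?_ ?_ (hasDerivAt_const s 0)).deriv
  · exact ((hω.sin.const_mul (Real.sin θ₀ * ω)).neg).congr_deriv (by ring)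
  · exact (hω.cos.const_mul (Real.sin θ₀ * ω)).congr_deriv (by ring)

theorem norm_deriv_latitudeCurve_sq (θ₀ ω s : ℝ) :
    ‖deriv (latitudeCurve θ₀ ω) s‖ ^ 2 = (Real.sin θ₀ * ω) ^ 2 := by
  rw [deriv_latitudeCurve, EuclideanSpace.norm_sq_eq]
  simp only [Fin.sum_univ_three, Real.norm_eq_abs, sq_abs]
  simp
  linear_combination (Real.sin θ₀ * ω) ^ 2 * Real.sin_sq_add_cos_sq (ω * s)

/-- for `cos θ₀ ≠ 0` and `ω = B₀ / cos θ₀`, the circle of latitude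
`γ(s) = (sin θ₀ cos(ωs), sin θ₀ sin(ωs), cos θ₀)` satisfies the magnetic geodesic equation
`γ'' = −‖γ'‖²γ + B₀ (γ × γ')` on the two-sphere. -/
theorem statement14 (θ₀ B₀ : ℝ) (hθ₀ : Real.cos θ₀ ≠ 0) :
    ∀ s : ℝ,
      deriv (deriv (latitudeCurve θ₀ (B₀ / Real.cos θ₀))) s
        = -(‖deriv (latitudeCurve θ₀ (B₀ / Real.cos θ₀)) s‖ ^ 2) •
              latitudeCurve θ₀ (B₀ / Real.cos θ₀) s
          + B₀ • cross3 (latitudeCurve θ₀ (B₀ / Real.cos θ₀) s)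
              (deriv (latitudeCurve θ₀ (B₀ / Real.cos θ₀)) s) := by
  intro s
  obtain ⟨ω, hω⟩ : ∃ ω, ω = B₀ / Real.cos θ₀ := ⟨_, rfl⟩
  have hB : B₀ = ω * Real.cos θ₀ := by rw [hω, div_mul_cancel₀ _ hθ₀]
  rw [← hω, norm_deriv_latitudeCurve_sq, deriv_deriv_latitudeCurve, deriv_latitudeCurve, hB]
  have hθ := Real.sin_sq_add_cos_sq θ₀
  ext i
  fin_cases i
  · simp [cross3, latitudeCurve]
    linear_combination (Real.sin θ₀ * ω ^ 2 * Real.cos (ω * s)) * hθ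
  · simp [cross3, latitudeCurve]
    linear_combination (Real.sin θ₀ * ω ^ 2 * Real.sin (ω * s)) * hθ
  · simp [cross3, latitudeCurve]
    linear_combination
      (-(ω ^ 2 * Real.sin θ₀ ^ 2 * Real.cos θ₀)) * Real.sin_sq_add_cos_sq (ω * s)
end

section
/- Let B₀ ∈ ℝ and let θ : ℝ → ℝ be differentiable with θ'(t) = sin(θ(t))·(B₀ − cos(θ(t))) for all t. Then the map γ : ℝ × ℝ → ℝ³ defined by γ(s,t) = (sin θ(t)·cos s, sin θ(t)·sin s, cos θ(t)) satisfies the magnetic geodesic heat flow equation on the two-sphere: ∂ₜγ(s,t) = ∂ₛ∂ₛγ(s,t) + ‖∂ₛγ(s,t)‖² γ(s,t) − B₀ (γ(s,t) × ∂ₛγ(s,t)) for all (s,t). -/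
/-- The circle-of-latitude ansatz for the magnetic heat flow on the unit sphere, with
time-dependent polar angle `θ(t)`. -/
noncomputable def sphereAnsatz (θ : ℝ → ℝ) (s t : ℝ) : EuclideanSpace ℝ (Fin 3) :=
  (WithLp.equiv 2 (Fin 3 → ℝ)).symm
    ![Real.sin (θ t) * Real.cos s, Real.sin (θ t) * Real.sin s, Real.cos (θ t)]

theorem hasDerivAt_toLp_vec3 {f g h : ℝ → ℝ} {f' g' h' x : ℝ} (hf : HasDerivAt f f' x)
    (hg : HasDerivAt g g' x) (hh : HasDerivAt h h' x) :
    HasDerivAt (fun y => (WithLp.equiv 2 (Fin 3 → ℝ)).symm ![f y, g y, h y] :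
      ℝ → EuclideanSpace ℝ (Fin 3)) ((WithLp.equiv 2 (Fin 3 → ℝ)).symm ![f', g', h']) x := by
  have key : HasDerivAt (fun y => ![f y, g y, h y]) ![f', g', h'] x := by
    rw [hasDerivAt_pi]
    intro i
    fin_cases i
    exacts [hf, hg, hh]
  exact (PiLp.continuousLinearEquiv 2 ℝ (fun _ : Fin 3 => ℝ)).symm.hasFDerivAt.comp_hasDerivAt x key

theorem deriv_sphereAnsatz_longitude (θ : ℝ → ℝ) (s t : ℝ) :
    deriv (fun u => sphereAnsatz θ u t) s = (WithLp.equiv 2 (Fin 3 → ℝ)).symm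
      ![Real.sin (θ t) * -Real.sin s, Real.sin (θ t) * Real.cos s, 0] :=
  (hasDerivAt_toLp_vec3 ((Real.hasDerivAt_cos s).const_mul _)
    ((Real.hasDerivAt_sin s).const_mul _) (hasDerivAt_const s _)).deriv

theorem deriv_deriv_sphereAnsatz_longitude (θ : ℝ → ℝ) (s t : ℝ) :
    deriv (fun s' => deriv (fun u => sphereAnsatz θ u t) s') s = (WithLp.equiv 2 (Fin 3 → ℝ)).symm
      ![Real.sin (θ t) * -Real.cos s, Real.sin (θ t) * -Real.sin s, 0] := by
  simp only [deriv_sphereAnsatz_longitude]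
  exact (hasDerivAt_toLp_vec3 ((Real.hasDerivAt_sin s).neg.const_mul _)
    ((Real.hasDerivAt_cos s).const_mul _) (hasDerivAt_const s _)).deriv

theorem deriv_sphereAnsatz_time {θ : ℝ → ℝ} {θ' t : ℝ} (hθ : HasDerivAt θ θ' t) (s : ℝ) :
    deriv (fun t' => sphereAnsatz θ s t') t = (WithLp.equiv 2 (Fin 3 → ℝ)).symm
      ![Real.cos (θ t) * θ' * Real.cos s, Real.cos (θ t) * θ' * Real.sin s,
        -Real.sin (θ t) * θ'] :=
  (hasDerivAt_toLp_vec3 (hθ.sin.mul_const _) (hθ.sin.mul_const _) hθ.cos).deriv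

theorem norm_sq_deriv_sphereAnsatz_longitude (θ : ℝ → ℝ) (s t : ℝ) :
    ‖deriv (fun u => sphereAnsatz θ u t) s‖ ^ 2 = Real.sin (θ t) ^ 2 := by
  rw [deriv_sphereAnsatz_longitude, EuclideanSpace.norm_sq_eq]
  simp [Fin.sum_univ_three, mul_pow]
  rw [← mul_add, Real.sin_sq_add_cos_sq, mul_one]

/-- if `θ' = sin θ (B₀ − cos θ)`, then the circle-of-latitude ansatz
`γ(s,t) = (sin θ(t) cos s, sin θ(t) sin s, cos θ(t))` solves the magnetic heat flow
`∂ₜγ = ∂ₛ∂ₛγ + ‖∂ₛγ‖²γ − B₀ (γ × ∂ₛγ)` on the two-sphere. -/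
theorem statement15 (B₀ : ℝ) (θ : ℝ → ℝ)
    (hθ : ∀ t : ℝ, HasDerivAt θ (Real.sin (θ t) * (B₀ - Real.cos (θ t))) t) :
    ∀ s t : ℝ,
      deriv (fun t' => sphereAnsatz θ s t') t
        = deriv (fun s' => deriv (fun u => sphereAnsatz θ u t) s') s
          + (‖deriv (fun u => sphereAnsatz θ u t) s‖ ^ 2) • sphereAnsatz θ s t
          - B₀ • cross3 (sphereAnsatz θ s t) (deriv (fun u => sphereAnsatz θ u t) s) := by
  intro s t
  rw [norm_sq_deriv_sphereAnsatz_longitude, deriv_deriv_sphereAnsatz_longitude,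
    deriv_sphereAnsatz_longitude, deriv_sphereAnsatz_time (hθ t)]
  have hs := Real.sin_sq_add_cos_sq s
  have hθt := Real.sin_sq_add_cos_sq (θ t)
  ext i
  fin_cases i <;> simp [sphereAnsatz, cross3] <;> grind
end

section
/- Let B₀ ∈ (−1,1) and set θ₀ = arccos B₀ ∈ (0,π). Let θ : [0,∞) → ℝ be differentiable with θ'(t) = sin(θ(t))·(B₀ − cos(θ(t))) for all t ≥ 0. If θ(0) ∈ (0, θ₀), then θ(t) → 0 as t → ∞; if θ(0) ∈ (θ₀, π), then θ(t) → π as t → ∞; and if θ(0) = θ₀, then θ(t) = θ₀ for all t. -/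
section AutonomousScalarODE

variable {v x : ℝ → ℝ} {K : NNReal} {a b c : ℝ}

/-- A solution of a Lipschitz autonomous ODE that meets an equilibrium at some time is constant. -/
theorem eq_equilibrium_of_meets (hv : LipschitzWith K v)
    (hx : ∀ t : ℝ, 0 ≤ t → HasDerivAt x (v (x t)) t) (hc : v c = 0)
    {s : ℝ} (hs : 0 ≤ s) (hxs : x s = c) {t : ℝ} (ht : 0 ≤ t) : x t = c := by
  have hconst : ∀ r : ℝ, HasDerivAt (fun _ : ℝ => c) (v c) r := fun r => by
    rw [hc]; exact hasDerivAt_const r c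
  rcases le_total s t with hst | hts
  · exact ODE_solution_unique (v := fun _ => v) (f := x) (g := fun _ => c) (a := s) (b := t)
      (fun _ => hv)
      (fun r hr => (hx r (hs.trans hr.1)).continuousAt.continuousWithinAt)
      (fun r hr => (hx r (hs.trans hr.1)).hasDerivWithinAt) continuousOn_const
      (fun r _ => (hconst r).hasDerivWithinAt) hxs ⟨hst, le_rfl⟩
  · exact ODE_solution_unique_of_mem_Icc_left (v := fun _ => v) (s := fun _ => Set.univ)
      (f := x) (g := fun _ => c) (a := t) (b := s)
      (fun _ _ => hv.lipschitzOnWith)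
      (fun r hr => (hx r (ht.trans hr.1)).continuousAt.continuousWithinAt)
      (fun r hr => (hx r (ht.trans hr.1.le)).hasDerivWithinAt) (fun _ _ => trivial)
      continuousOn_const
      (fun r _ => (hconst r).hasDerivWithinAt) (fun _ _ => trivial) hxs ⟨le_rfl, hts⟩

/-- A solution starting between two equilibria of a Lipschitz autonomous ODE stays there. -/
theorem mem_Ioo_of_equilibria (hv : LipschitzWith K v)
    (hx : ∀ t : ℝ, 0 ≤ t → HasDerivAt x (v (x t)) t) (ha : v a = 0) (hb : v b = 0)
    (h0 : x 0 ∈ Set.Ioo a b) {t : ℝ} (ht : 0 ≤ t) : x t ∈ Set.Ioo a b := by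
  have hcont : ContinuousOn x (Set.Icc 0 t) := fun r hr =>
    (hx r hr.1).continuousAt.continuousWithinAt
  constructor
  · by_contra! h
    obtain ⟨s, hs, hxs⟩ := intermediate_value_Icc' ht hcont ⟨h, h0.1.le⟩
    exact h0.1.ne' (eq_equilibrium_of_meets hv hx ha hs.1 hxs le_rfl)
  · by_contra! h
    obtain ⟨s, hs, hxs⟩ := intermediate_value_Icc ht hcont ⟨h0.2.le, h⟩
    exact h0.2.ne (eq_equilibrium_of_meets hv hx hb hs.1 hxs le_rfl)

/-- If a Lipschitz vector field is negative between two consecutive equilibria, solutions starting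
there converge to the lower one. -/
theorem tendsto_lower_equilibrium (hv : LipschitzWith K v)
    (hx : ∀ t : ℝ, 0 ≤ t → HasDerivAt x (v (x t)) t) (ha : v a = 0) (hb : v b = 0)
    (hneg : ∀ y ∈ Set.Ioo a b, v y < 0) (h0 : x 0 ∈ Set.Ioo a b) :
    Filter.Tendsto x Filter.atTop (nhds a) := by
  have hmem : ∀ t, 0 ≤ t → x t ∈ Set.Ioo a b := fun t ht =>
    mem_Ioo_of_equilibria hv hx ha hb h0 ht
  have hcont : ContinuousOn x (Set.Ici 0) := fun r hr =>
    (hx r hr).continuousAt.continuousWithinAt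
  have hdiff : DifferentiableOn ℝ x (interior (Set.Ici 0)) := fun r hr =>
    (hx r (interior_subset hr)).differentiableAt.differentiableWithinAt
  have hanti : AntitoneOn x (Set.Ici 0) := by
    refine antitoneOn_of_deriv_nonpos (convex_Ici 0) hcont hdiff fun r hr => ?_
    rw [(hx r (interior_subset hr)).deriv]
    exact (hneg _ (hmem r (interior_subset hr))).le
  have hbelow : ∀ y, a < y → ∃ t, 0 ≤ t ∧ x t < y := by
    intro y hy
    by_contra! h
    have hsub : Set.Icc y (x 0) ⊆ Set.Ioo a b := fun z hz =>
      ⟨hy.trans_le hz.1, hz.2.trans_lt h0.2⟩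
    obtain ⟨z, hz, hmax⟩ := isCompact_Icc.exists_isMaxOn
      (Set.nonempty_Icc.2 (h 0 le_rfl)) (hv.continuous.continuousOn (s := Set.Icc y (x 0)))
    have hvz : v z < 0 := hneg z (hsub hz)
    have hdecay : ∀ t, 0 ≤ t → x t - x 0 ≤ v z * (t - 0) := fun t ht =>
      (convex_Ici 0).image_sub_le_mul_sub_of_deriv_le hcont hdiff (fun r hr => by
        have hr' : 0 ≤ r := interior_subset hr
        rw [(hx r hr').deriv]
        exact hmax ⟨h r hr', hanti Set.self_mem_Ici hr' hr'⟩) 0 Set.self_mem_Ici t ht ht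
    have hT : 0 ≤ (a - x 0) / v z :=
      div_nonneg_of_nonpos (sub_nonpos.2 h0.1.le) hvz.le
    have hxT := hdecay _ hT
    rw [sub_zero, mul_div_cancel₀ _ hvz.ne] at hxT
    linarith [(hmem _ hT).1]
  refine tendsto_order.2 ⟨fun y hy => ?_, fun y hy => ?_⟩
  · filter_upwards [Filter.eventually_ge_atTop 0] with t ht using hy.trans (hmem t ht).1
  · obtain ⟨s, hs, hxs⟩ := hbelow y hy
    filter_upwards [Filter.eventually_ge_atTop s] with t ht
    exact (hanti hs (hs.trans ht) ht).trans_lt hxs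

/-- If a Lipschitz vector field is positive between two consecutive equilibria, solutions starting
there converge to the upper one. -/
theorem tendsto_upper_equilibrium (hv : LipschitzWith K v)
    (hx : ∀ t : ℝ, 0 ≤ t → HasDerivAt x (v (x t)) t) (ha : v a = 0) (hb : v b = 0)
    (hpos : ∀ y ∈ Set.Ioo a b, 0 < v y) (h0 : x 0 ∈ Set.Ioo a b) :
    Filter.Tendsto x Filter.atTop (nhds b) := by
  have hlip : LipschitzWith K fun y => -v (-y) := LipschitzWith.of_dist_le_mul fun y z => by
    simpa only [dist_neg_neg] using hv.dist_le_mul (-y) (-z)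
  have h := tendsto_lower_equilibrium (x := fun t => -x t) (a := -b) (b := -a) hlip
    (fun t ht => by simpa only [neg_neg] using (hx t ht).fun_neg) (by simp [hb]) (by simp [ha])
    (fun y hy => neg_neg_of_pos (hpos (-y) ⟨by linarith [hy.2], by linarith [hy.1]⟩))
    ⟨neg_lt_neg h0.2, neg_lt_neg h0.1⟩
  simpa only [neg_neg] using h.neg

end AutonomousScalarODE

theorem lipschitzWith_sin_mul_sub_cos {B : ℝ} (hB : |B| ≤ 1) :
    LipschitzWith 3 fun y : ℝ => Real.sin y * (B - Real.cos y) := by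
  have hderiv : ∀ y : ℝ, HasDerivAt (fun y : ℝ => Real.sin y * (B - Real.cos y))
      (Real.cos y * (B - Real.cos y) + Real.sin y * Real.sin y) y := fun y => by
    simpa using (Real.hasDerivAt_sin y).fun_mul ((Real.hasDerivAt_cos y).const_sub B)
  refine lipschitzWith_of_nnnorm_deriv_le (fun y => (hderiv y).differentiableAt) fun y => ?_
  rw [(hderiv y).deriv, ← NNReal.coe_le_coe, coe_nnnorm, Real.norm_eq_abs]
  have hcB : |Real.cos y * B| ≤ 1 := by
    rw [abs_mul]
    exact mul_le_one₀ (Real.abs_cos_le_one y) (abs_nonneg B) hB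
  obtain ⟨h1, h2⟩ := abs_le.1 hcB
  rw [NNReal.coe_ofNat, abs_le]
  constructor <;> nlinarith [Real.sin_sq_add_cos_sq y, sq_nonneg (Real.sin y),
    sq_nonneg (Real.cos y)]

/-- for the ODE `θ' = sin θ (B₀ − cos θ)` on `[0,∞)` with `B₀ ∈ (−1,1)` and
`θ₀ = arccos B₀`: solutions starting in `(0, θ₀)` tend to `0`, solutions starting in
`(θ₀, π)` tend to `π`, and the solution starting at `θ₀` is constant. -/
theorem statement16 (B₀ : ℝ) (hB : B₀ ∈ Set.Ioo (-1 : ℝ) 1) (θ : ℝ → ℝ)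
    (hθ : ∀ t : ℝ, 0 ≤ t → HasDerivAt θ (Real.sin (θ t) * (B₀ - Real.cos (θ t))) t) :
    (θ 0 ∈ Set.Ioo 0 (Real.arccos B₀) → Filter.Tendsto θ Filter.atTop (nhds 0))
    ∧ (θ 0 ∈ Set.Ioo (Real.arccos B₀) Real.pi → Filter.Tendsto θ Filter.atTop (nhds Real.pi))
    ∧ (θ 0 = Real.arccos B₀ → ∀ t : ℝ, 0 ≤ t → θ t = Real.arccos B₀) := by
  have hlip := lipschitzWith_sin_mul_sub_cos (abs_le.2 ⟨hB.1.le, hB.2.le⟩)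
  have hcos : Real.cos (Real.arccos B₀) = B₀ := Real.cos_arccos hB.1.le hB.2.le
  have hzero : Real.sin (Real.arccos B₀) * (B₀ - Real.cos (Real.arccos B₀)) = 0 := by
    rw [hcos, sub_self, mul_zero]
  refine ⟨tendsto_lower_equilibrium hlip hθ (by simp) hzero fun y hy => ?_,
    tendsto_upper_equilibrium hlip hθ hzero (by simp) fun y hy => ?_,
    fun h t ht => eq_equilibrium_of_meets hlip hθ hzero le_rfl h ht⟩
  · have hlt := Real.cos_lt_cos_of_nonneg_of_le_pi hy.1.le (Real.arccos_le_pi B₀) hy.2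
    rw [hcos] at hlt
    exact mul_neg_of_pos_of_neg
      (Real.sin_pos_of_pos_of_lt_pi hy.1 (hy.2.trans_le (Real.arccos_le_pi B₀)))
      (sub_neg.2 hlt)
  · have hlt := Real.cos_lt_cos_of_nonneg_of_le_pi (Real.arccos_nonneg B₀) hy.2.le hy.1
    rw [hcos] at hlt
    exact mul_pos (Real.sin_pos_of_pos_of_lt_pi ((Real.arccos_nonneg B₀).trans_lt hy.1) hy.2)
      (sub_pos.2 hlt)
end

section
/- Let B₀ > 1 and let θ₀ > 0 be the unique positive real with cosh θ₀ = B₀. Let θ : [0,∞) → ℝ be differentiable with θ'(t) = sinh(θ(t))·(B₀ − cosh(θ(t))) for all t ≥ 0 and θ(0) > 0. Then θ(t) → θ₀ as t → ∞. -/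
theorem eq_mul_exp_neg_integral_of_hasDerivAt {a w : ℝ → ℝ} (ha : Continuous a)
    (hw : ∀ t : ℝ, 0 ≤ t → HasDerivAt w (-(a t) * w t) t) {t : ℝ} (ht : 0 ≤ t) :
    w t = w 0 * Real.exp (-∫ s in (0 : ℝ)..t, a s) := by
  have hd : ∀ x : ℝ, 0 ≤ x →
      HasDerivAt (fun x => w x * Real.exp (∫ s in (0 : ℝ)..x, a s)) 0 x := fun x hx => by
    have hG : HasDerivAt (fun x => ∫ s in (0 : ℝ)..x, a s) (a x) x :=
      intervalIntegral.integral_hasDerivAt_right (ha.intervalIntegrable _ _)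
        ha.aestronglyMeasurable.stronglyMeasurableAtFilter ha.continuousAt
    exact ((hw x hx).mul hG.exp).congr_deriv (by ring)
  have hconst := constant_of_has_deriv_right_zero (a := 0) (b := t)
    (fun x hx => (hd x hx.1).continuousAt.continuousWithinAt)
    (fun x hx => (hd x hx.1).hasDerivWithinAt) t ⟨ht, le_rfl⟩
  simp only [intervalIntegral.integral_same, Real.exp_zero, mul_one] at hconst
  rw [← hconst, mul_assoc, ← Real.exp_add, add_neg_cancel, Real.exp_zero, mul_one]

/-- Convergence of `cosh θ` along positive functions forces convergence of `θ`. -/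
theorem tendsto_of_tendsto_cosh {α : Type*} {l : Filter α} {θ : α → ℝ} {θ₀ : ℝ}
    (hθ₀ : 0 ≤ θ₀) (hθ : ∀ᶠ t in l, 0 ≤ θ t)
    (h : Filter.Tendsto (fun t => Real.cosh (θ t)) l (nhds (Real.cosh θ₀))) :
    Filter.Tendsto θ l (nhds θ₀) := by
  have key : ∀ x : ℝ, 0 ≤ x → Real.arsinh (√(Real.cosh x ^ 2 - 1)) = x := fun x hx => by
    rw [Real.cosh_sq, add_sub_cancel_right, Real.sqrt_sq (Real.sinh_nonneg_iff.2 hx),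
      Real.arsinh_sinh]
  have hlim := (((h.pow 2).sub_const 1).sqrt).arsinh
  rw [key θ₀ hθ₀] at hlim
  exact hlim.congr' (hθ.mono fun t ht => key _ ht)


/-- for the ODE `θ' = sinh θ (B₀ − cosh θ)` on `[0,∞)` with `B₀ > 1` and
`θ₀ > 0` the unique positive solution of `cosh θ₀ = B₀`: every solution with `θ(0) > 0`
converges to `θ₀` as `t → ∞`. -/
theorem statement19 (B₀ : ℝ) (hB : 1 < B₀) (θ₀ : ℝ) (hθ₀ : 0 < θ₀)
    (hcosh : Real.cosh θ₀ = B₀) (θ : ℝ → ℝ)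
    (hθ : ∀ t : ℝ, 0 ≤ t → HasDerivAt θ (Real.sinh (θ t) * (B₀ - Real.cosh (θ t))) t)
    (h0 : 0 < θ 0) :
    Filter.Tendsto θ Filter.atTop (nhds θ₀) := by
  have hcont : ContinuousOn θ (Set.Ici 0) := fun t ht =>
    (hθ t ht).continuousAt.continuousWithinAt
  -- The coefficient of the linear equation for `cosh θ - B₀`, extended evenly to `ℝ`.
  let a : ℝ → ℝ := fun t => Real.sinh (θ |t|) ^ 2
  have ha : Continuous a :=
    (Real.continuous_sinh.comp
      (hcont.comp_continuous continuous_abs fun t => abs_nonneg t)).pow 2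
  have hw : ∀ t : ℝ, 0 ≤ t →
      HasDerivAt (fun t => Real.cosh (θ t) - B₀) (-(a t) * (Real.cosh (θ t) - B₀)) t :=
    fun t ht => by
      refine ((hθ t ht).cosh.sub_const B₀).congr_deriv ?_
      simp only [a, abs_of_nonneg ht]
      ring
  have hsol := fun {t : ℝ} (ht : 0 ≤ t) => eq_mul_exp_neg_integral_of_hasDerivAt ha hw ht
  obtain ⟨c, hc1, hcB, hc0⟩ : ∃ c : ℝ, 1 < c ∧ c ≤ B₀ ∧ c ≤ Real.cosh (θ 0) :=
    ⟨min B₀ (Real.cosh (θ 0)), lt_min hB (Real.one_lt_cosh.2 h0.ne'),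
      min_le_left _ _, min_le_right _ _⟩
  have hlow : ∀ t : ℝ, 0 ≤ t → c ≤ Real.cosh (θ t) := fun t ht => by
    have hE1 : Real.exp (-∫ s in (0 : ℝ)..t, a s) ≤ 1 :=
      Real.exp_le_one_iff.2 <| neg_nonpos.2 <|
        intervalIntegral.integral_nonneg ht fun s _ => sq_nonneg _
    have hE0 := Real.exp_pos (-∫ s in (0 : ℝ)..t, a s)
    have := hsol ht
    nlinarith
  have hpos : ∀ t : ℝ, 0 ≤ t → 0 < θ t := fun t ht => by
    by_contra! hneg
    obtain ⟨s, hs, hs0⟩ := intermediate_value_Icc' ht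
      (hcont.mono Set.Icc_subset_Ici_self) ⟨hneg, h0.le⟩
    have := hlow s hs.1
    rw [hs0, Real.cosh_zero] at this
    linarith
  have hdecay : ∀ t : ℝ, 0 ≤ t → (c ^ 2 - 1) * t ≤ ∫ s in (0 : ℝ)..t, a s := fun t ht => by
    have hle : ∀ s ∈ Set.Icc 0 t, c ^ 2 - 1 ≤ a s := fun s _ => by
      have := hlow |s| (abs_nonneg s)
      simp only [a, Real.sinh_sq]
      gcongr
    have hmono := intervalIntegral.integral_mono_on (μ := MeasureTheory.volume) ht
      intervalIntegrable_const (ha.intervalIntegrable 0 t) hle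
    rwa [intervalIntegral.integral_const, sub_zero, smul_eq_mul, mul_comm] at hmono
  have hint : Filter.Tendsto (fun t => ∫ s in (0 : ℝ)..t, a s) Filter.atTop Filter.atTop :=
    Filter.tendsto_atTop_mono' _ ((Filter.eventually_ge_atTop 0).mono hdecay)
      (Filter.tendsto_id.const_mul_atTop (by nlinarith))
  refine tendsto_of_tendsto_cosh hθ₀.le
    ((Filter.eventually_ge_atTop 0).mono fun t ht => (hpos t ht).le) ?_
  have hlim := ((Real.tendsto_exp_neg_atTop_nhds_zero.comp hint).const_mul
    (Real.cosh (θ 0) - B₀)).add_const B₀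
  rw [mul_zero, zero_add, ← hcosh] at hlim
  refine hlim.congr' ((Filter.eventually_ge_atTop 0).mono fun t ht => ?_)
  have := hsol ht
  simp only [Function.comp_apply, hcosh]
  linarith
end
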